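/- Let m, n ≥ 2 and α, β, γ real with mn + αm + βn + γ > 0, and define the bipartite depolarizing map Φ_{αβγ} on mn×mn complex matrices (identified with operators on ℂ^m ⊗ ℂ^n) by Φ_{αβγ}[X] = (tr(X)·I_{mn} + α·I_m ⊗ tr_A(X) + β·tr_B(X) ⊗ I_n + γX)/(mn + αm + βn + γ), where tr_A is the partial trace over the first (m-dimensional) factor and tr_B is the partial trace over the second (n-dimensional) factor. Assume Φ_{αβγ} is a positive map. Then Φ_{αβγ} is absolutely separating with respect to the bipartition m|n provided that either: (a) α²m + β²n + 2γ(α+β) ≥ 0 and (α+β+γ)² + α²(m−1) + β²(n−1) − 1 ≤ (αm + βn + γ + 1)²/(mn−1); or (b) α²m + β²n + 2γ(α+β) ≤ 0 and γ² + 2αβ − 1 + (α²m + β²n + 2γ(α+β))/min(m,n) ≤ (αm + βn + γ + 1)²/(mn−1). -/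

import Mathlib

open Matrix Kronecker BigOperators
open scoped ComplexOrder

noncomputable section


def IsDM {ι : Type*} [Fintype ι] (ρ : Matrix ι ι ℂ) : Prop :=
  ρ.PosSemidef ∧ ρ.trace = 1

def IsSep {ι κ : Type*} [Fintype ι] [Fintype κ]
    (ρ : Matrix (ι × κ) (ι × κ) ℂ) : Prop :=
  ∃ (k : ℕ) (p : Fin k → ℝ) (A : Fin k → Matrix ι ι ℂ) (B : Fin k → Matrix κ κ ℂ),
    (∀ i, 0 ≤ p i) ∧ (∑ i, p i = 1) ∧ (∀ i, IsDM (A i)) ∧ (∀ i, IsDM (B i)) ∧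
    ρ = ∑ i, (p i : ℂ) • (A i ⊗ₖ B i)

def IsAbsSep {ι κ : Type*} [Fintype ι] [Fintype κ] [DecidableEq ι] [DecidableEq κ]
    (ρ : Matrix (ι × κ) (ι × κ) ℂ) : Prop :=
  ∀ U : Matrix (ι × κ) (ι × κ) ℂ, U * Uᴴ = 1 → IsSep (U * ρ * Uᴴ)

/-- Partial trace over the first factor. -/
def ptrA {m n : ℕ} (X : Matrix (Fin m × Fin n) (Fin m × Fin n) ℂ) :
    Matrix (Fin n) (Fin n) ℂ :=
  Matrix.of fun j j' => ∑ i, X (i, j) (i, j')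

/-- Partial trace over the second factor. -/
def ptrB {m n : ℕ} (X : Matrix (Fin m × Fin n) (Fin m × Fin n) ℂ) :
    Matrix (Fin m) (Fin m) ℂ :=
  Matrix.of fun i i' => ∑ j, X (i, j) (i', j)

/-- The bipartite depolarizing map `Φ_{αβγ}`. -/
def bidepol (m n : ℕ) (α β γ : ℝ)
    (X : Matrix (Fin m × Fin n) (Fin m × Fin n) ℂ) :
    Matrix (Fin m × Fin n) (Fin m × Fin n) ℂ :=
  ((((m : ℝ) * n + α * m + β * n + γ : ℝ)) : ℂ)⁻¹ •
    (X.trace • (1 : Matrix (Fin m × Fin n) (Fin m × Fin n) ℂ) +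
      (α : ℂ) • ((1 : Matrix (Fin m) (Fin m) ℂ) ⊗ₖ ptrA X) +
      (β : ℂ) • (ptrB X ⊗ₖ (1 : Matrix (Fin n) (Fin n) ℂ)) +
      (γ : ℂ) • X)


/-- quadratic form discriminant for complex scalars -/
lemma disc_scalar (a c : ℝ) (b : ℂ)
    (h : ∀ s t : ℂ, 0 ≤ Complex.normSq s * a + Complex.normSq t * c + 2 * (star s * t * b).re) :
    0 ≤ a ∧ 0 ≤ c ∧ Complex.normSq b ≤ a * c := by
  have ha : 0 ≤ a := by simpa using h 1 0
  have hc : 0 ≤ c := by simpa using h 0 1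
  refine ⟨ha, hc, ?_⟩
  have key : ∀ r : ℝ, 0 ≤ (Complex.normSq b) * (c * (r * r)) + (2 * Complex.normSq b) * r + a := by
    intro r
    have := h 1 (r * star b)
    have e : (star (1:ℂ) * (r * star b) * b).re = r * Complex.normSq b := by
      simp [Complex.normSq_apply]; ring
    rw [e] at this
    simp [Complex.normSq_mul, Complex.normSq_conj] at this
    nlinarith [this]
  by_cases hb : Complex.normSq b = 0
  · rw [hb]; positivity
  have hb' : 0 < Complex.normSq b := lt_of_le_of_ne (Complex.normSq_nonneg b) (Ne.symm hb)
  by_cases hc0 : c = 0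
  · exfalso
    subst hc0
    have := key (-(a+1) / (2 * Complex.normSq b))
    field_simp at this
    nlinarith
  · have hc' : 0 < c := lt_of_le_of_ne hc (Ne.symm hc0)
    have := key (-1/c)
    field_simp at this
    nlinarith

lemma psd_entry {κ : Type*} [Fintype κ] [DecidableEq κ] {P : Matrix κ κ ℂ} (hP : P.PosSemidef)
    (i j : κ) : Complex.normSq (P i j) ≤ (P i i).re * (P j j).re := by
  refine (disc_scalar _ _ _ ?_).2.2
  intro s t
  have h := hP.dotProduct_mulVec_nonneg (Pi.single i s + Pi.single j t)
  have h2 : P j i = star (P i j) := (hP.1.apply j i).symm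
  have h3 := (Complex.le_def.1 h).1
  have h4 : (P i i).im = 0 := by
    have := congrArg Complex.im (hP.1.apply i i)
    simp at this; linarith
  have h5 : (P j j).im = 0 := by
    have := congrArg Complex.im (hP.1.apply j j)
    simp at this; linarith
  have e : star (Pi.single i s + Pi.single j t) ⬝ᵥ P *ᵥ (Pi.single i s + Pi.single j t)
      = star s * P i i * s + star s * P i j * t + star t * P j i * s + star t * P j j * t := by
    simp [Matrix.mulVec_add, dotProduct_add, add_dotProduct, Matrix.mulVec_single, Pi.star_single]
    ring
  rw [e, h2] at h3
  simp [Complex.normSq_apply, h4, h5] at h3 ⊢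
  nlinarith [h3]

def frob {κ : Type*} [Fintype κ] (B : Matrix κ κ ℂ) : ℝ := ∑ i, ∑ j, Complex.normSq (B i j)

lemma frob_eq {κ : Type*} [Fintype κ] (B : Matrix κ κ ℂ) : ((B * Bᴴ).trace).re = frob B := by
  simp [frob, Matrix.trace, Matrix.mul_apply, Complex.normSq_apply]

lemma polar {κ : Type*} [Fintype κ] [DecidableEq κ] (B : Matrix κ κ ℂ) (hB : IsUnit B.det) :
    ∃ U : Matrix κ κ ℂ, U * Uᴴ = 1 ∧ frob B ≤ Complex.normSq (B * U).trace := by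
  obtain ⟨P, hP, hPP⟩ : ∃ P : Matrix κ κ ℂ, P.PosSemidef ∧ P * P = B * Bᴴ := by
    have hpsd := Matrix.posSemidef_self_mul_conjTranspose B
    have hh := hpsd.1
    refine ⟨(hh.eigenvectorUnitary : Matrix κ κ ℂ) * diagonal (fun i => ((Real.sqrt (hh.eigenvalues i) : ℝ) : ℂ)) * (hh.eigenvectorUnitary : Matrix κ κ ℂ)ᴴ, ?_, ?_⟩
    · apply PosSemidef.mul_mul_conjTranspose_same
      apply PosSemidef.diagonal
      intro i
      simp [Real.sqrt_nonneg]
    · have hu : (hh.eigenvectorUnitary : Matrix κ κ ℂ)ᴴ * (hh.eigenvectorUnitary : Matrix κ κ ℂ) = 1 :=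
        Unitary.coe_star_mul_self _
      have hs := hh.spectral_theorem
      rw [Unitary.conjStarAlgAut_apply] at hs
      conv_rhs => rw [hs]
      rw [show ∀ V D W : Matrix κ κ ℂ, V * D * W * (V * D * W) = V * (D * (W * V) * D) * W by
        intros; simp only [Matrix.mul_assoc], hu, mul_one, diagonal_mul_diagonal]
      congr 3
      ext i
      have := hpsd.eigenvalues_nonneg i
      simp only [Function.comp]
      rw [← Complex.ofReal_mul, Real.mul_self_sqrt this]
      rfl
  refine ⟨B⁻¹ * P, ?_, ?_⟩
  · rw [conjTranspose_mul, hP.1.eq, Matrix.mul_assoc, ← Matrix.mul_assoc P, hPP, Matrix.mul_assoc,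
      ← Matrix.mul_assoc, Matrix.nonsing_inv_mul _ hB, one_mul, ← conjTranspose_mul,
      Matrix.nonsing_inv_mul _ hB, conjTranspose_one]
  · rw [← Matrix.mul_assoc, Matrix.mul_nonsing_inv _ hB, one_mul, ← frob_eq, ← hPP]
    have h1 : ((P * P).trace).re = frob P := by rw [← frob_eq, hP.1.eq]
    rw [h1]
    calc frob P ≤ ∑ i, ∑ j, (P i i).re * (P j j).re :=
          Finset.sum_le_sum fun i _ => Finset.sum_le_sum fun j _ => psd_entry hP i j
      _ = P.trace.re * P.trace.re := by
          simp [Matrix.trace, Finset.sum_mul_sum]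
      _ ≤ _ := by
          rw [Complex.normSq_apply]; nlinarith [mul_self_nonneg P.trace.im]

lemma unitary_diag {κ : Type*} [Fintype κ] [DecidableEq κ] (U : Matrix κ κ ℂ) (hU : U * Uᴴ = 1) :
    ∃ (V : Matrix κ κ ℂ) (c : κ → ℂ), V * Vᴴ = 1 ∧ Vᴴ * V = 1 ∧ (∀ k, ‖c k‖ = 1) ∧
      U = V * diagonal c * Vᴴ := by
  have hU' : Uᴴ * U = 1 := mul_eq_one_comm.1 hU
  -- choose a phase
  obtain ⟨w, hw1, hw2⟩ : ∃ w : ℂ, ‖w‖ = 1 ∧ IsUnit (algebraMap ℂ (Matrix κ κ ℂ) w - U) := by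
    by_contra hcon
    push Not at hcon
    have hsub : Metric.sphere (0:ℂ) 1 ⊆ spectrum ℂ U := by
      intro w hw
      rw [spectrum.mem_iff]
      exact hcon w (by simpa using hw)
    have hfin := (Matrix.finite_spectrum U).subset hsub
    have : (Metric.sphere (0:ℂ) 1).Infinite := by
      refine (isPreconnected_sphere (by simp [Complex.rank_real_complex]) 0 1).infinite_of_nontrivial ?_
      exact ⟨1, by simp, -1, by simp, by norm_num⟩
    exact this hfin
  set Q := algebraMap ℂ (Matrix κ κ ℂ) w - U with hQ
  have hwne : w ≠ 0 := by intro h; simp [h] at hw1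
  have hww : w * star w = 1 := by
    have : w * star w = ((Complex.normSq w : ℝ) : ℂ) := Complex.mul_conj w
    rw [this, Complex.normSq_eq_norm_sq, hw1]; simp
  have hQd : IsUnit Q.det := (Matrix.isUnit_iff_isUnit_det Q).1 hw2
  -- H = i (w + U) Q⁻¹
  set H := Complex.I • ((algebraMap ℂ (Matrix κ κ ℂ) w + U) * Q⁻¹) with hH
  have hQ1 : Q = w • 1 - U := by rw [hQ, Algebra.algebraMap_eq_smul_one]
  have hQH : Qᴴ = (star w) • 1 - Uᴴ := by rw [hQ1]; simp
  have hherm : H.IsHermitian := by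
    -- show Qᴴ * (H) * Q symmetric
    have e1 : H * Q = Complex.I • (w • 1 + U) := by
      rw [hH, smul_mul_assoc, Matrix.mul_assoc, Matrix.nonsing_inv_mul _ hQd, mul_one,
        Algebra.algebraMap_eq_smul_one]
    have e2 : Qᴴ * H * Q = Complex.I • (star w • U - w • Uᴴ) := by
      rw [Matrix.mul_assoc, e1, hQH]
      simp only [mul_smul_comm, sub_mul, mul_add, smul_mul_assoc, one_mul, mul_one, hU', smul_sub, smul_add, smul_smul]
      have : star w * w = 1 := by rw [mul_comm]; exact hww
      have h3 : Complex.I * star w * w = Complex.I := by rw [mul_assoc, this, mul_one]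
      have h4 : w * star w = 1 := hww
      simp only [mul_assoc, h4, this, mul_one]
      abel
    have e3 : (Qᴴ * H * Q)ᴴ = Qᴴ * H * Q := by
      rw [e2]
      simp only [conjTranspose_smul, conjTranspose_sub, conjTranspose_conjTranspose, star_star]
      simp
      rw [← smul_neg, neg_sub]
    have e4 : Qᴴ * Hᴴ * Q = Qᴴ * H * Q := by
      rw [← e3]; simp [Matrix.mul_assoc]
    have hQHd : IsUnit Qᴴ.det := by rw [det_conjTranspose]; exact hQd.star
    have e5 : Qᴴ * Hᴴ = Qᴴ * H := by
      have := congrArg (· * Q⁻¹) e4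
      simpa [Matrix.mul_assoc, Matrix.mul_nonsing_inv _ hQd] using this
    have := congrArg (Qᴴ⁻¹ * ·) e5
    change Hᴴ = H
    simpa [← Matrix.mul_assoc, Matrix.nonsing_inv_mul _ hQHd] using this
  -- U (H + i) = w (H - i)
  have hrel : U * (H + Complex.I • 1) = w • (H - Complex.I • 1) := by
    have hQi : (1 : Matrix κ κ ℂ) = Q * Q⁻¹ := (Matrix.mul_nonsing_inv _ hQd).symm
    have a1 : H + Complex.I • 1 = (2 * Complex.I * w) • Q⁻¹ := by
      have : H + Complex.I • 1 = Complex.I • ((w • 1 + U + Q) * Q⁻¹) := by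
        rw [add_mul, ← hQi, smul_add, hH, Algebra.algebraMap_eq_smul_one]
      rw [this, hQ1]
      rw [show w • (1 : Matrix κ κ ℂ) + U + (w • 1 - U) = (2 * w) • 1 by rw [two_mul, add_smul]; abel]
      rw [smul_mul_assoc, one_mul, smul_smul]; congr 1; ring
    have a2 : H - Complex.I • 1 = (2 * Complex.I) • (U * Q⁻¹) := by
      have : H - Complex.I • 1 = Complex.I • ((w • 1 + U - Q) * Q⁻¹) := by
        rw [sub_mul, ← hQi, smul_sub, hH, Algebra.algebraMap_eq_smul_one]
      rw [this, hQ1]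
      rw [show w • (1 : Matrix κ κ ℂ) + U - (w • 1 - U) = (2:ℂ) • U by rw [two_smul]; abel]
      rw [smul_mul_assoc, smul_smul]; congr 1; ring
    rw [a1, a2, mul_smul_comm, smul_smul]; congr 1; ring
  set V := (hherm.eigenvectorUnitary : Matrix κ κ ℂ) with hV
  have hV1 : Vᴴ * V = 1 := Unitary.coe_star_mul_self _
  have hV2 : V * Vᴴ = 1 := Unitary.coe_mul_star_self _
  have hs : H = V * diagonal (fun i => ((hherm.eigenvalues i : ℝ) : ℂ)) * Vᴴ := by
    have hs := hherm.spectral_theorem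
    rw [Unitary.conjStarAlgAut_apply] at hs
    exact hs
  have hne : ∀ x : ℝ, (x : ℂ) + Complex.I ≠ 0 := by
    intro x h
    have := congrArg Complex.im h
    simp at this
  refine ⟨V, fun k => w * ((hherm.eigenvalues k : ℂ) - Complex.I) / ((hherm.eigenvalues k : ℂ) + Complex.I), hV2, hV1, ?_, ?_⟩
  · intro k
    have : ‖(hherm.eigenvalues k : ℂ) - Complex.I‖ = ‖(hherm.eigenvalues k : ℂ) + Complex.I‖ := by
      rw [← Complex.norm_conj]; simp
    rw [norm_div, norm_mul, hw1, one_mul, this, div_self]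
    exact norm_ne_zero_iff.2 (hne _)
  · set D := diagonal (fun i => ((hherm.eigenvalues i : ℝ) : ℂ)) with hD
    have b1 : Vᴴ * U * V * (D + Complex.I • 1) = w • (D - Complex.I • 1) := by
      have c1 : Vᴴ * (H + Complex.I • 1) * V = D + Complex.I • 1 := by
        rw [mul_add, add_mul, hs]
        simp only [← Matrix.mul_assoc, hV1, one_mul]
        rw [Matrix.mul_assoc, hV1, mul_one]; simp [hV1]
      have c2 : Vᴴ * (H - Complex.I • 1) * V = D - Complex.I • 1 := by
        rw [mul_sub, sub_mul, hs]
        simp only [← Matrix.mul_assoc, hV1, one_mul]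
        rw [Matrix.mul_assoc, hV1, mul_one]; simp [hV1]
      rw [← c1, ← c2]
      rw [show Vᴴ * U * V * (Vᴴ * (H + Complex.I • 1) * V) = Vᴴ * U * (V * Vᴴ) * (H + Complex.I • 1) * V by simp only [Matrix.mul_assoc]]
      rw [hV2, mul_one, Matrix.mul_assoc Vᴴ, hrel]; simp
    have b2 : Vᴴ * U * V = diagonal (fun k => w * ((hherm.eigenvalues k : ℂ) - Complex.I) / ((hherm.eigenvalues k : ℂ) + Complex.I)) := by
      have d1 : D + Complex.I • 1 = diagonal (fun i => (hherm.eigenvalues i : ℂ) + Complex.I) := by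
        rw [hD, ← diagonal_one, ← diagonal_smul, diagonal_add]; simp
      have d2 : w • (D - Complex.I • 1) = diagonal (fun i => w * ((hherm.eigenvalues i : ℂ) - Complex.I)) := by
        rw [hD, ← diagonal_one, ← diagonal_smul, diagonal_sub, ← diagonal_smul]; congr 1; ext i; simp
      rw [d1, d2] at b1
      ext i j
      have := congrFun (congrFun b1 i) j
      rw [mul_diagonal] at this
      by_cases hij : i = j
      · subst hij
        simp only [diagonal_apply_eq] at this ⊢
        rw [← this]; field_simp [hne]
      · simp only [diagonal_apply_ne _ hij] at this ⊢
        exact (mul_eq_zero.1 this).resolve_right (hne _)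
    rw [← b2]
    rw [show V * (Vᴴ * U * V) * Vᴴ = V * Vᴴ * U * (V * Vᴴ) by simp only [Matrix.mul_assoc], hV2]
    simp

lemma trace_unitary_bound {κ : Type*} [Fintype κ] [DecidableEq κ] (A B C U : Matrix κ κ ℂ)
    (hA : ∀ y : κ → ℂ, 0 ≤ (star y ⬝ᵥ A *ᵥ y).re)
    (hC : ∀ y : κ → ℂ, 0 ≤ (star y ⬝ᵥ C *ᵥ y).re)
    (hB : ∀ y : κ → ℂ, Complex.normSq (star y ⬝ᵥ B *ᵥ y) ≤
      (star y ⬝ᵥ A *ᵥ y).re * (star y ⬝ᵥ C *ᵥ y).re)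
    (hU : U * Uᴴ = 1) :
    ‖(B * U).trace‖ ^ 2 ≤ A.trace.re * C.trace.re := by
  obtain ⟨V, c, hV1, hV2, hc, rfl⟩ := unitary_diag U hU
  have hq : ∀ (M : Matrix κ κ ℂ) k, (Vᴴ * M * V) k k = star (fun i => V i k) ⬝ᵥ M *ᵥ (fun i => V i k) := by
    intro M k
    rw [Matrix.mul_assoc, Matrix.mul_apply]
    rfl
  have htr : ∀ M : Matrix κ κ ℂ, M.trace = ∑ k, (Vᴴ * M * V) k k := by
    intro M
    have : M.trace = (Vᴴ * M * V).trace := by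
      rw [Matrix.trace_mul_comm, ← Matrix.mul_assoc, hV1, one_mul]
    rw [this]; rfl
  have h1 : (B * (V * diagonal c * Vᴴ)).trace = ∑ k, (Vᴴ * B * V) k k * c k := by
    rw [show B * (V * diagonal c * Vᴴ) = (B * V * diagonal c) * Vᴴ by simp only [Matrix.mul_assoc],
      Matrix.trace_mul_comm, ← Matrix.mul_assoc, ← Matrix.mul_assoc]
    simp [Matrix.trace, mul_diagonal]
  rw [h1, htr A, htr C, Complex.re_sum, Complex.re_sum]
  calc _ ≤ (∑ k, ‖(Vᴴ * B * V) k k‖) ^ 2 := by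
        gcongr
        refine (norm_sum_le _ _).trans (le_of_eq ?_)
        simp [hc]
    _ ≤ _ := by
        apply Finset.sum_sq_le_sum_mul_sum_of_sq_le_mul
        · intro k _; rw [hq]; exact hA _
        · intro k _; rw [hq]; exact hC _
        · intro k _; rw [hq, hq, hq, ← Complex.normSq_eq_norm_sq]; exact hB _

lemma frob_bound {κ : Type*} [Fintype κ] [DecidableEq κ] (A B C : Matrix κ κ ℂ)
    (hA : ∀ y : κ → ℂ, 0 ≤ (star y ⬝ᵥ A *ᵥ y).re)
    (hC : ∀ y : κ → ℂ, 0 ≤ (star y ⬝ᵥ C *ᵥ y).re)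
    (hB : ∀ y : κ → ℂ, Complex.normSq (star y ⬝ᵥ B *ᵥ y) ≤
      (star y ⬝ᵥ A *ᵥ y).re * (star y ⬝ᵥ C *ᵥ y).re) :
    frob B ≤ A.trace.re * C.trace.re := by
  set c := Real.sqrt (A.trace.re * C.trace.re) with hcdef
  have h0 : 0 ≤ A.trace.re * C.trace.re :=
    le_trans (sq_nonneg _) (trace_unitary_bound A B C 1 hA hC hB (by simp))
  have hone : ∀ U : Matrix κ κ ℂ, U * Uᴴ = 1 → ‖U.trace‖ ≤ Fintype.card κ := by
    intro U hU
    have hp : ∀ y : κ → ℂ, star y ⬝ᵥ (1 : Matrix κ κ ℂ) *ᵥ y = ((∑ i, Complex.normSq (y i) : ℝ) : ℂ) := by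
      intro y
      simp [dotProduct, Complex.normSq_eq_conj_mul_self]
    have hn : ∀ y : κ → ℂ, 0 ≤ (star y ⬝ᵥ (1 : Matrix κ κ ℂ) *ᵥ y).re := by
      intro y; rw [hp, Complex.ofReal_re]; exact Finset.sum_nonneg fun i _ => Complex.normSq_nonneg _
    have := trace_unitary_bound 1 1 1 U hn hn (by
      intro y; rw [hp, Complex.ofReal_re, Complex.normSq_ofReal]) hU
    rw [one_mul] at this
    simp at this
    nlinarith [norm_nonneg U.trace, (Nat.cast_nonneg (Fintype.card κ) : (0:ℝ) ≤ _)]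
  -- perturbation
  have hpert : ∀ ε : ℝ, (B + (ε : ℂ) • 1).det ≠ 0 →
      frob (B + (ε : ℂ) • 1) ≤ (c + |ε| * Fintype.card κ) ^ 2 := by
    intro ε hε
    obtain ⟨U, hU, hf⟩ := polar (B + (ε : ℂ) • 1) (isUnit_iff_ne_zero.2 hε)
    refine hf.trans ?_
    rw [Complex.normSq_eq_norm_sq]
    gcongr
    rw [add_mul, trace_add, smul_mul_assoc, one_mul, trace_smul]
    refine (norm_add_le _ _).trans ?_
    gcongr
    · apply Real.le_sqrt_of_sq_le
      exact trace_unitary_bound A B C U hA hC hB hU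
    · rw [norm_smul]; simp only [Complex.norm_real, Real.norm_eq_abs]
      gcongr
      exact hone U hU
  have hev : ∀ᶠ ε : ℝ in nhdsWithin 0 {0}ᶜ, (B + (ε : ℂ) • 1).det ≠ 0 := by
    have hfin : {ε : ℝ | (B + (ε : ℂ) • 1).det = 0}.Finite := by
      have : {ε : ℝ | (B + (ε : ℂ) • 1).det = 0} ⊆ (fun e : ℝ => -(e : ℂ)) ⁻¹' (spectrum ℂ B) := by
        intro e he
        simp only [Set.mem_preimage, spectrum.mem_iff, Algebra.algebraMap_eq_smul_one]
        rw [Matrix.isUnit_iff_isUnit_det, isUnit_iff_ne_zero, not_not]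
        rw [show (-(e:ℂ)) • (1 : Matrix κ κ ℂ) - B = -(B + (e:ℂ) • 1) by rw [neg_smul]; abel, det_neg]
        rw [show (B + (e:ℂ) • 1).det = 0 from he, mul_zero]
      refine ((Matrix.finite_spectrum B).preimage ?_).subset this
      intro a _ b _ hab
      simpa using hab
    have h1 : ({ε : ℝ | (B + (ε : ℂ) • 1).det = 0} \ {0})ᶜ ∈ nhds (0:ℝ) := by
      apply IsOpen.mem_nhds
      · exact (hfin.subset Set.sdiff_subset).isClosed.isOpen_compl
      · simp
    filter_upwards [mem_nhdsWithin_of_mem_nhds h1, self_mem_nhdsWithin] with e he he0 hd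
    exact he ⟨hd, he0⟩
  have hl : Filter.Tendsto (fun ε : ℝ => frob (B + (ε : ℂ) • 1)) (nhdsWithin 0 {0}ᶜ) (nhds (frob B)) := by
    have : Continuous (fun ε : ℝ => frob (B + (ε : ℂ) • 1)) := by
      unfold frob
      simp only [Matrix.add_apply, Matrix.smul_apply]
      refine continuous_finsetSum _ fun i _ => continuous_finsetSum _ fun j _ => ?_
      refine Complex.continuous_normSq.comp ?_
      fun_prop
    have h := (this.tendsto 0).mono_left (nhdsWithin_le_nhds (s := {0}ᶜ))
    simpa using h
  have hr : Filter.Tendsto (fun ε : ℝ => (c + |ε| * Fintype.card κ) ^ 2) (nhdsWithin 0 {0}ᶜ) (nhds (c ^ 2)) := by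
    have : Continuous (fun ε : ℝ => (c + |ε| * Fintype.card κ) ^ 2) := by fun_prop
    have h := (this.tendsto 0).mono_left (nhdsWithin_le_nhds (s := {0}ᶜ))
    simpa using h
  have := le_of_tendsto_of_tendsto hl hr (hev.mono hpert)
  rwa [hcdef, Real.sq_sqrt h0] at this

/-- block positive -/
lemma blockpos_frob {ι κ : Type*} [Fintype ι] [Fintype κ] [DecidableEq ι] [DecidableEq κ]
    (W : Matrix (ι × κ) (ι × κ) ℂ) (hW : W.IsHermitian)
    (hb : ∀ (x : ι → ℂ) (y : κ → ℂ),
      0 ≤ (star (fun p : ι × κ => x p.1 * y p.2) ⬝ᵥ W *ᵥ (fun p : ι × κ => x p.1 * y p.2)).re) :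
    0 ≤ W.trace.re ∧ frob W ≤ W.trace.re ^ 2 := by
  let blk : ι → ι → Matrix κ κ ℂ := fun i j => Matrix.of fun k l => W (i, k) (j, l)
  have hG : ∀ y : κ → ℂ, (Matrix.of fun i j => star y ⬝ᵥ blk i j *ᵥ y : Matrix ι ι ℂ).PosSemidef := by
    intro y
    have hherm : (Matrix.of fun i j => star y ⬝ᵥ blk i j *ᵥ y : Matrix ι ι ℂ).IsHermitian := by
      ext i j
      simp only [conjTranspose_apply, of_apply, dotProduct, mulVec, blk, star_sum, star_mul', Pi.star_apply, star_star, Finset.mul_sum]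
      rw [Finset.sum_comm]
      refine Finset.sum_congr rfl fun k _ => Finset.sum_congr rfl fun l _ => ?_
      rw [hW.apply]; ring
    refine PosSemidef.of_dotProduct_mulVec_nonneg hherm ?_
    intro x
    have e : star x ⬝ᵥ (Matrix.of fun i j => star y ⬝ᵥ blk i j *ᵥ y : Matrix ι ι ℂ) *ᵥ x =
       star (fun p : ι × κ => x p.1 * y p.2) ⬝ᵥ W *ᵥ (fun p : ι × κ => x p.1 * y p.2) := by
      simp only [of_apply, dotProduct, mulVec, blk, star_mul', Pi.star_apply, Finset.mul_sum, Finset.sum_mul, Fintype.sum_prod_type]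
      refine Finset.sum_congr rfl fun i _ => ?_
      rw [Finset.sum_comm]
      refine Finset.sum_congr rfl fun k _ => Finset.sum_congr rfl fun j _ => Finset.sum_congr rfl fun l _ => ?_
      ring
    rw [Complex.nonneg_iff]
    refine ⟨by rw [e]; exact hb x y, ?_⟩
    have := hherm.im_star_dotProduct_mulVec_self x
    simpa using this.symm
  have hnn : ∀ i (y : κ → ℂ), 0 ≤ (star y ⬝ᵥ blk i i *ᵥ y).re := by
    intro i y
    exact (Complex.nonneg_iff.1 ((hG y).diag_nonneg (i := i))).1
  have hbd : ∀ i j, frob (blk i j) ≤ (blk i i).trace.re * (blk j j).trace.re := by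
    intro i j
    exact frob_bound _ _ _ (hnn i) (hnn j) fun y => psd_entry (hG y) i j
  have htr : W.trace.re = ∑ i, (blk i i).trace.re := by
    simp [Matrix.trace, Fintype.sum_prod_type, blk]
  have hfr : frob W = ∑ i, ∑ j, frob (blk i j) := by
    simp only [frob, Fintype.sum_prod_type, blk, of_apply]
    refine Finset.sum_congr rfl fun i _ => ?_
    rw [Finset.sum_comm]
  constructor
  · rw [htr]
    refine Finset.sum_nonneg fun i _ => ?_
    simp only [Matrix.trace, Complex.re_sum, diag_apply]
    refine Finset.sum_nonneg fun k _ => ?_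
    have := hnn i (Pi.single k 1)
    simpa [Pi.star_single] using this
  · rw [hfr, htr, sq, Finset.sum_mul_sum]
    exact Finset.sum_le_sum fun i _ => Finset.sum_le_sum fun j _ => hbd i j

lemma compact_hull {E : Type*} [NormedAddCommGroup E] [NormedSpace ℝ E] [FiniteDimensional ℝ E]
    {P : Set E} (hP : IsCompact P) : IsCompact (convexHull ℝ P) := by
  rcases P.eq_empty_or_nonempty with rfl | ⟨p0, hp0⟩
  · simp
  let N := Module.finrank ℝ E + 1
  let K : Set ((Fin N → ℝ) × (Fin N → E)) := stdSimplex ℝ (Fin N) ×ˢ (Set.univ.pi fun _ => P)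
  have hK : IsCompact K := (isCompact_stdSimplex ℝ (Fin N)).prod (isCompact_univ_pi fun _ => hP)
  let f : ((Fin N → ℝ) × (Fin N → E)) → E := fun q => ∑ i, q.1 i • q.2 i
  have hf : Continuous f := by
    apply continuous_finsetSum
    intro i _
    fun_prop
  have himg : convexHull ℝ P = f '' K := by
    apply Set.Subset.antisymm
    · intro x hx
      obtain ⟨ι, hι, z, w, hz, hai, hw, hw1, hx'⟩ := eq_pos_convex_span_of_mem_convexHull hx
      have hcard : Fintype.card ι ≤ Fintype.card (Fin N) := by
        have h1 := hai.card_le_finrank_succ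
        have h2 := Submodule.finrank_le (vectorSpan ℝ (Set.range z))
        simp [N]; omega
      obtain ⟨e⟩ := Function.Embedding.nonempty_of_card_le hcard
      have hex : ∀ i, i ∉ Set.range e → ¬ ∃ a, e a = i := fun i h h' => h h'
      refine ⟨(Function.extend e w 0, Function.extend e z (fun _ => p0)), ⟨⟨?_, ?_⟩, ?_⟩, ?_⟩
      · intro i
        by_cases h : ∃ a, e a = i
        · obtain ⟨a, rfl⟩ := h
          simp only [e.injective.extend_apply]; exact (hw a).le
        · simp only [Function.extend_apply' _ _ _ h]; exact le_rfl
      · rw [← hw1]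
        symm
        apply Fintype.sum_of_injective e e.injective
        · intro i hi; simp only [Function.extend_apply' _ _ _ (hex i hi)]; rfl
        · intro i; simp only [e.injective.extend_apply]
      · intro i _
        by_cases h : ∃ a, e a = i
        · obtain ⟨a, rfl⟩ := h
          simp only [e.injective.extend_apply]; exact hz ⟨a, rfl⟩
        · simp only [Function.extend_apply' _ _ _ h]; exact hp0
      · rw [← hx']
        symm
        apply Fintype.sum_of_injective e e.injective
        · intro i hi; simp only [Function.extend_apply' _ _ _ (hex i hi)]; simp
        · intro i; simp only [e.injective.extend_apply]
    · rintro _ ⟨⟨w, z⟩, ⟨⟨hw0, hw1⟩, hz⟩, rfl⟩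
      exact (convex_convexHull ℝ P).sum_mem (fun i _ => hw0 i) hw1
        fun i _ => subset_convexHull ℝ P (hz i (Set.mem_univ i))
  rw [himg]
  exact hK.image hf

/-- unit vectors -/
def unitVec (ι : Type*) [Fintype ι] : Set (ι → ℂ) := {x | ∑ i, Complex.normSq (x i) = 1}

lemma compact_unitVec (ι : Type*) [Fintype ι] : IsCompact (unitVec ι) := by
  apply Metric.isCompact_of_isClosed_isBounded
  · apply isClosed_eq _ continuous_const
    exact continuous_finsetSum _ fun i _ => Complex.continuous_normSq.comp (continuous_apply i)
  · refine (Metric.isBounded_closedBall (x := (0 : ι → ℂ)) (r := 1)).subset ?_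
    intro x hx
    rw [mem_closedBall_zero_iff, pi_norm_le_iff_of_nonneg zero_le_one]
    intro i
    have h : Complex.normSq (x i) ≤ 1 := by
      rw [← show ∑ i, Complex.normSq (x i) = 1 from hx]
      exact Finset.single_le_sum (f := fun i => Complex.normSq (x i)) (fun j _ => Complex.normSq_nonneg _) (Finset.mem_univ i)
    rw [Complex.normSq_eq_norm_sq] at h
    nlinarith [norm_nonneg (x i)]

def pureDM {ι : Type*} (x : ι → ℂ) : Matrix ι ι ℂ := vecMulVec x (star x)

lemma isDM_pure {ι : Type*} [Fintype ι] {x : ι → ℂ} (hx : x ∈ unitVec ι) : IsDM (pureDM x) := by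
  refine ⟨posSemidef_vecMulVec_self_star x, ?_⟩
  have : (pureDM x).trace = ((∑ i, Complex.normSq (x i) : ℝ) : ℂ) := by
    simp [pureDM, Matrix.trace, vecMulVec_apply, Complex.mul_conj]
  rw [this, show ∑ i, Complex.normSq (x i) = 1 from hx]; simp

def prodPure (ι κ : Type*) [Fintype ι] [Fintype κ] : Set (Matrix (ι × κ) (ι × κ) ℂ) :=
  (fun q : (ι → ℂ) × (κ → ℂ) => pureDM q.1 ⊗ₖ pureDM q.2) '' (unitVec ι ×ˢ unitVec κ)

lemma hull_isSep {ι κ : Type*} [Fintype ι] [Fintype κ] {σ : Matrix (ι × κ) (ι × κ) ℂ}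
    (h : σ ∈ convexHull ℝ (prodPure ι κ)) : IsSep σ := by
  rw [mem_convexHull_iff_exists_fintype] at h
  obtain ⟨J, hJ, w, z, hw0, hw1, hz, rfl⟩ := h
  choose q hq hqz using hz
  let e := Fintype.equivFin J
  refine ⟨Fintype.card J, w ∘ e.symm, fun i => pureDM (q (e.symm i)).1,
    fun i => pureDM (q (e.symm i)).2, fun i => hw0 _, ?_, fun i => isDM_pure (hq _).1,
    fun i => isDM_pure (hq _).2, ?_⟩
  · rw [← hw1]; exact Equiv.sum_comp e.symm w
  · rw [← Equiv.sum_comp e.symm]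
    refine Finset.sum_congr rfl fun i _ => ?_
    rw [← hqz]
    ext a b
    simp

section GB

attribute [local instance] Matrix.normedAddCommGroup Matrix.normedSpace

lemma closed_hull (ι κ : Type*) [Fintype ι] [Fintype κ] :
    IsClosed (convexHull ℝ (prodPure ι κ)) := by
  apply IsCompact.isClosed
  apply compact_hull
  apply ((compact_unitVec ι).prod (compact_unitVec κ)).image
  refine continuous_pi fun a => continuous_pi fun b => ?_
  simp only [pureDM, kroneckerMap_apply, vecMulVec_apply, Pi.star_apply]
  fun_prop

lemma hscale {τ : Type*} [Fintype τ] (x : τ → ℂ) (hx : x ≠ 0) : ∃ r : ℝ, 0 ≤ r ∧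
      ∃ x' ∈ unitVec τ, pureDM x = (r : ℂ) • pureDM x' := by
    set r := ∑ i, Complex.normSq (x i) with hr
    have hr0 : 0 < r := by
      obtain ⟨i, hi⟩ := Function.ne_iff.1 hx
      exact Finset.sum_pos' (fun j _ => Complex.normSq_nonneg _) ⟨i, Finset.mem_univ i, Complex.normSq_pos.2 hi⟩
    have hs : Real.sqrt r ≠ 0 := (Real.sqrt_pos.2 hr0).ne'
    have hss : Real.sqrt r * Real.sqrt r = r := Real.mul_self_sqrt hr0.le
    refine ⟨r, hr0.le, fun i => ((Real.sqrt r)⁻¹ : ℝ) * x i, ?_, ?_⟩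
    · change ∑ i, Complex.normSq (((Real.sqrt r)⁻¹ : ℝ) * x i) = 1
      simp only [Complex.normSq_mul, Complex.normSq_ofReal, ← Finset.mul_sum]
      rw [← hr, ← mul_inv, hss, inv_mul_cancel₀ hr0.ne']
    · ext i j
      simp only [pureDM, vecMulVec_apply, Pi.star_apply, Matrix.smul_apply, star_mul', smul_eq_mul]
      have : (r : ℂ) * ((((Real.sqrt r)⁻¹ : ℝ) : ℂ) * star (((Real.sqrt r)⁻¹ : ℝ) : ℂ)) = 1 := by
        rw [show star (((Real.sqrt r)⁻¹ : ℝ) : ℂ) = (((Real.sqrt r)⁻¹ : ℝ) : ℂ) from Complex.conj_ofReal _]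
        rw [← Complex.ofReal_mul, ← Complex.ofReal_mul, ← mul_inv, hss, mul_inv_cancel₀ hr0.ne']; simp
      calc x i * star (x j) = ((r : ℂ) * ((((Real.sqrt r)⁻¹ : ℝ) : ℂ) * star (((Real.sqrt r)⁻¹ : ℝ) : ℂ))) * (x i * star (x j)) := by rw [this, one_mul]
        _ = _ := by ring

/-- Gurvits–Barnum. -/
lemma gurvits_barnum {ι κ : Type*} [Fintype ι] [Fintype κ] [DecidableEq ι] [DecidableEq κ]
    (σ : Matrix (ι × κ) (ι × κ) ℂ) (hσ : σ.IsHermitian) (htr : σ.trace = 1)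
    (hd : 1 < (Fintype.card (ι × κ) : ℝ))
    (hp : frob σ * ((Fintype.card (ι × κ) : ℝ) - 1) ≤ 1) :
    σ ∈ convexHull ℝ (prodPure ι κ) := by
  by_contra hn
  have : LocallyConvexSpace ℝ (Matrix (ι × κ) (ι × κ) ℂ) :=
    inferInstanceAs (LocallyConvexSpace ℝ ((ι × κ) → (ι × κ) → ℂ))
  obtain ⟨f, u, hfu, hfb⟩ := RCLike.geometric_hahn_banach_point_closed (𝕜 := ℂ)
    (convex_convexHull ℝ (prodPure ι κ)) (closed_hull ι κ) hn
  let F : Matrix (ι × κ) (ι × κ) ℂ := Matrix.of fun q p => f (Matrix.single p q 1)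
  have hF : ∀ X, f X = (F * X).trace := by
    intro X
    conv_lhs => rw [matrix_eq_sum_single X]
    simp only [map_sum, Matrix.trace, diag_apply, Matrix.mul_apply]
    rw [Finset.sum_comm]
    refine Finset.sum_congr rfl fun q _ => Finset.sum_congr rfl fun p _ => ?_
    rw [show Matrix.single p q (X p q) = X p q • Matrix.single p q (1:ℂ) by simp, map_smul]
    simp [F, mul_comm]
  let W : Matrix (ι × κ) (ι × κ) ℂ := (1/2 : ℂ) • (F + Fᴴ) - (u : ℂ) • 1
  have hWh : W.IsHermitian := by
    change Wᴴ = W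
    simp [W, add_comm]
  have hWX : ∀ X : Matrix (ι × κ) (ι × κ) ℂ, X.IsHermitian → X.trace = 1 →
      ((W * X).trace).re = (f X).re - u := by
    intro X hX h1
    have h2 : (Fᴴ * X).trace = star ((F * X).trace) := by
      rw [← trace_conjTranspose, conjTranspose_mul, hX.eq, trace_mul_comm]
    simp only [W, sub_mul, smul_mul_assoc, add_mul, one_mul, trace_sub, trace_smul, trace_add, h1, h2, hF]
    simp
    ring
  have hneg : ((W * σ).trace).re < 0 := by
    rw [hWX σ hσ htr]; have : (f σ).re < u := hfu; linarith
  have hpure : ∀ x ∈ unitVec ι, ∀ y ∈ unitVec κ, 0 ≤ ((W * (pureDM x ⊗ₖ pureDM y)).trace).re := by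
    intro x hx y hy
    have hx' := isDM_pure hx
    have hy' := isDM_pure hy
    have hmem : pureDM x ⊗ₖ pureDM y ∈ convexHull ℝ (prodPure ι κ) :=
      subset_convexHull ℝ _ ⟨(x, y), ⟨hx, hy⟩, rfl⟩
    rw [hWX]
    · have : u < (f (pureDM x ⊗ₖ pureDM y)).re := hfb _ hmem
      linarith
    · change (pureDM x ⊗ₖ pureDM y)ᴴ = _
      rw [conjTranspose_kronecker, hx'.1.1.eq, hy'.1.1.eq]
    · rw [trace_kronecker, hx'.2, hy'.2, one_mul]
  have hquad : ∀ (x : ι → ℂ) (y : κ → ℂ),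
      star (fun p : ι × κ => x p.1 * y p.2) ⬝ᵥ W *ᵥ (fun p : ι × κ => x p.1 * y p.2) =
        (W * (pureDM x ⊗ₖ pureDM y)).trace := by
    intro x y
    simp only [dotProduct, mulVec, Matrix.trace, diag_apply, Matrix.mul_apply, pureDM,
      kroneckerMap_apply, vecMulVec_apply, Pi.star_apply, star_mul', Finset.mul_sum]
    refine Finset.sum_congr rfl fun p _ => Finset.sum_congr rfl fun q _ => ?_
    ring
  have hb : ∀ (x : ι → ℂ) (y : κ → ℂ),
      0 ≤ (star (fun p : ι × κ => x p.1 * y p.2) ⬝ᵥ W *ᵥ (fun p : ι × κ => x p.1 * y p.2)).re := by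
    intro x y
    by_cases hx : x = 0
    · subst hx
      have : (fun p : ι × κ => (0 : ι → ℂ) p.1 * y p.2) = 0 := by ext; simp
      rw [this]; simp
    by_cases hy : y = 0
    · subst hy
      have : (fun p : ι × κ => x p.1 * (0 : κ → ℂ) p.2) = 0 := by ext; simp
      rw [this]; simp
    rw [hquad]
    obtain ⟨r, hr, x', hx', ex⟩ := hscale x hx
    obtain ⟨s, hs, y', hy', ey⟩ := hscale y hy
    rw [ex, ey, smul_kronecker, kronecker_smul, mul_smul_comm, mul_smul_comm, trace_smul, trace_smul]
    simp only [smul_eq_mul, Complex.re_ofReal_mul]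
    exact mul_nonneg hr (mul_nonneg hs (hpure x' hx' y' hy'))
  obtain ⟨ht0, hfr⟩ := blockpos_frob W hWh hb
  -- Cauchy–Schwarz
  set d : ℝ := (Fintype.card (ι × κ) : ℝ) with hdd
  set Δ : Matrix (ι × κ) (ι × κ) ℂ := ((d - 1 : ℝ) : ℂ) • σ - 1 with hΔ
  have hΔh : Δᴴ = Δ := by
    rw [hΔ, conjTranspose_sub, conjTranspose_smul, hσ.eq]; simp
  have hΔf : frob Δ ≤ 1 := by
    have h1 : frob Δ = (d - 1) ^ 2 * frob σ - 2 * (d - 1) + d := by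
      rw [← frob_eq, ← frob_eq, hΔh, hσ.eq, hΔ]
      simp only [sub_mul, mul_sub, smul_mul_assoc, mul_smul_comm, one_mul, mul_one, trace_sub, trace_smul, htr, trace_one]
      simp only [smul_eq_mul, Complex.sub_re, Complex.re_ofReal_mul, Complex.one_re, Complex.natCast_re]
      rw [← hdd]; ring
    rw [h1]
    nlinarith
  have hcs : ((W * Δ).trace).re ^ 2 ≤ frob W * frob Δ := by
    have h1 : ((W * Δ).trace).re = ∑ p : (ι × κ) × (ι × κ), (W p.1 p.2 * Δ p.2 p.1).re := by
      rw [Fintype.sum_prod_type]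
      simp [Matrix.trace, Matrix.mul_apply]
    have h2 : ∀ M : Matrix (ι × κ) (ι × κ) ℂ, frob M = ∑ p : (ι × κ) × (ι × κ), Complex.normSq (M p.1 p.2) := by
      intro M; rw [Fintype.sum_prod_type]; rfl
    have h3 : frob Δ = ∑ p : (ι × κ) × (ι × κ), Complex.normSq (Δ p.2 p.1) := by
      rw [Fintype.sum_prod_type, Finset.sum_comm]; rfl
    rw [h1, h2, h3]
    apply Finset.sum_sq_le_sum_mul_sum_of_sq_le_mul
    · intro p _; exact Complex.normSq_nonneg _
    · intro p _; exact Complex.normSq_nonneg _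
    · intro p _
      rw [← Complex.normSq_mul, Complex.normSq_apply]
      nlinarith [mul_self_nonneg (W p.1 p.2 * Δ p.2 p.1).im]
  have hfin : ((W * Δ).trace).re = (d - 1) * ((W * σ).trace).re - W.trace.re := by
    rw [hΔ, mul_sub, mul_smul_comm, trace_sub, trace_smul, mul_one]
    simp only [smul_eq_mul, Complex.sub_re, Complex.re_ofReal_mul]
  have hlt : ((W * Δ).trace).re < - W.trace.re := by
    rw [hfin]; nlinarith
  have hW0 : 0 ≤ frob W := Finset.sum_nonneg fun i _ => Finset.sum_nonneg fun j _ => Complex.normSq_nonneg _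
  have : ((W * Δ).trace).re ^ 2 ≤ W.trace.re ^ 2 := by
    refine hcs.trans (le_trans ?_ hfr)
    nlinarith
  nlinarith

end GB

lemma trace_one_kron {m n : ℕ} (B : Matrix (Fin n) (Fin n) ℂ)
    (X : Matrix (Fin m × Fin n) (Fin m × Fin n) ℂ) :
    (((1 : Matrix (Fin m) (Fin m) ℂ) ⊗ₖ B) * X).trace = (B * ptrA X).trace := by
  simp only [Matrix.trace, diag_apply, Matrix.mul_apply, Fintype.sum_prod_type, kroneckerMap_apply,
    ptrA, of_apply, one_apply, ite_mul, one_mul, zero_mul]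
  simp only [Finset.sum_ite_irrel, Finset.sum_const_zero, Finset.sum_ite_eq, Finset.mem_univ, if_true,
    Finset.mul_sum]
  rw [Finset.sum_comm]
  refine Finset.sum_congr rfl fun k _ => ?_
  rw [Finset.sum_comm]

lemma trace_kron_one {m n : ℕ} (A : Matrix (Fin m) (Fin m) ℂ)
    (X : Matrix (Fin m × Fin n) (Fin m × Fin n) ℂ) :
    ((A ⊗ₖ (1 : Matrix (Fin n) (Fin n) ℂ)) * X).trace = (A * ptrB X).trace := by
  simp only [Matrix.trace, diag_apply, Matrix.mul_apply, Fintype.sum_prod_type, kroneckerMap_apply,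
    ptrB, of_apply, one_apply, mul_ite, mul_one, mul_zero, ite_mul, zero_mul]
  simp only [Finset.sum_ite_eq, Finset.mem_univ, if_true, Finset.mul_sum]
  refine Finset.sum_congr rfl fun k _ => ?_
  rw [Finset.sum_comm]

lemma trace_ptrA {m n : ℕ} (X : Matrix (Fin m × Fin n) (Fin m × Fin n) ℂ) :
    (ptrA X).trace = X.trace := by
  simp only [Matrix.trace, diag_apply, ptrA, of_apply, Fintype.sum_prod_type]
  rw [Finset.sum_comm]

lemma trace_ptrB {m n : ℕ} (X : Matrix (Fin m × Fin n) (Fin m × Fin n) ℂ) :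
    (ptrB X).trace = X.trace := by
  simp only [Matrix.trace, diag_apply, ptrB, of_apply, Fintype.sum_prod_type]

/-- purity bounds for a density matrix -/
lemma purity_bounds {n : ℕ} (A : Matrix (Fin n) (Fin n) ℂ) (hA : IsDM A) :
    frob A ≤ 1 ∧ 1 ≤ n * frob A := by
  have ht : ∑ i, (A i i).re = 1 := by
    have := congrArg Complex.re hA.2
    simpa [Matrix.trace] using this
  constructor
  · calc frob A ≤ ∑ i, ∑ j, (A i i).re * (A j j).re :=
          Finset.sum_le_sum fun i _ => Finset.sum_le_sum fun j _ => psd_entry hA.1 i j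
      _ = 1 := by rw [← Finset.sum_mul_sum, ht, one_mul]
  · have h1 : (∑ i, (A i i).re) ^ 2 ≤ n * ∑ i, (A i i).re ^ 2 := by
      have := sq_sum_le_card_mul_sum_sq (s := Finset.univ) (f := fun i => (A i i).re)
      simpa using this
    have h2 : ∑ i, (A i i).re ^ 2 ≤ frob A := by
      refine Finset.sum_le_sum fun i _ => ?_
      refine le_trans ?_ (Finset.single_le_sum (f := fun j => Complex.normSq (A i j))
        (fun j _ => Complex.normSq_nonneg _) (Finset.mem_univ i))
      simp only [Complex.normSq_apply]
      nlinarith [mul_self_nonneg (A i i).im]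
    rw [ht] at h1
    have : (n : ℝ) * ∑ i, (A i i).re ^ 2 ≤ n * frob A := by gcongr
    linarith

lemma pure_reduced {m n : ℕ} (ψ : Fin m × Fin n → ℂ) (hψ : ψ ∈ unitVec (Fin m × Fin n)) :
    ∃ μ : ℝ, μ ≤ 1 ∧ 1 ≤ m * μ ∧ 1 ≤ n * μ ∧
      (ptrA (pureDM ψ))ᴴ = ptrA (pureDM ψ) ∧ (ptrB (pureDM ψ))ᴴ = ptrB (pureDM ψ) ∧
      (ptrA (pureDM ψ) * ptrA (pureDM ψ)).trace = (μ : ℂ) ∧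
      (ptrB (pureDM ψ) * ptrB (pureDM ψ)).trace = (μ : ℂ) := by
  let Ψ : Matrix (Fin m) (Fin n) ℂ := Matrix.of fun i j => ψ (i, j)
  have hB : ptrB (pureDM ψ) = Ψ * Ψᴴ := by
    ext i j
    simp [ptrB, pureDM, vecMulVec_apply, Matrix.mul_apply, Ψ]
  have hA : ptrA (pureDM ψ) = (Ψᴴ * Ψ)ᵀ := by
    ext i j
    simp [ptrA, pureDM, vecMulVec_apply, Matrix.mul_apply, Ψ, mul_comm]
  have dB : IsDM (ptrB (pureDM ψ)) := by
    refine ⟨by rw [hB]; exact posSemidef_self_mul_conjTranspose Ψ, ?_⟩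
    rw [trace_ptrB]; exact (isDM_pure hψ).2
  have dA : IsDM (ptrA (pureDM ψ)) := by
    refine ⟨by rw [hA]; exact (posSemidef_conjTranspose_mul_self Ψ).transpose, ?_⟩
    rw [trace_ptrA]; exact (isDM_pure hψ).2
  have hreal : ∀ {k : ℕ} (A : Matrix (Fin k) (Fin k) ℂ), Aᴴ = A → (A * A).trace = ((frob A : ℝ) : ℂ) := by
    intro k A hAh
    have h1 : (A * A).trace.re = frob A := by rw [← frob_eq, hAh]
    have h2 : star (A * A).trace = (A * A).trace := by
      rw [← trace_conjTranspose, conjTranspose_mul, hAh]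
    rw [← h1]
    exact (Complex.conj_eq_iff_re.1 h2).symm
  have hAh := dA.1.1.eq
  have hBh := dB.1.1.eq
  have heq : (ptrA (pureDM ψ) * ptrA (pureDM ψ)).trace = (ptrB (pureDM ψ) * ptrB (pureDM ψ)).trace := by
    rw [hA, hB, ← transpose_mul, trace_transpose]
    rw [Matrix.mul_assoc, trace_mul_comm]
    simp only [Matrix.mul_assoc]
  have hfe : frob (ptrA (pureDM ψ)) = frob (ptrB (pureDM ψ)) := by
    have := heq
    rw [hreal _ hAh, hreal _ hBh] at this
    exact_mod_cast this
  refine ⟨frob (ptrB (pureDM ψ)), (purity_bounds _ dB).1, (purity_bounds _ dB).2, ?_, hAh, hBh, ?_, hreal _ hBh⟩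
  · rw [← hfe]; exact (purity_bounds _ dA).2
  · rw [← hfe]; exact hreal _ hAh

lemma bidepol_pure {m n : ℕ} (α β γ : ℝ) (hdenom : 0 < (m : ℝ) * n + α * m + β * n + γ)
    (ψ : Fin m × Fin n → ℂ) (hψ : ψ ∈ unitVec (Fin m × Fin n)) :
    (bidepol m n α β γ (pureDM ψ))ᴴ = bidepol m n α β γ (pureDM ψ) ∧
    (bidepol m n α β γ (pureDM ψ)).trace = 1 ∧
    ∃ μ : ℝ, μ ≤ 1 ∧ 1 ≤ m * μ ∧ 1 ≤ n * μ ∧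
      frob (bidepol m n α β γ (pureDM ψ)) * ((m : ℝ) * n + α * m + β * n + γ) ^ 2 =
        m * n + γ ^ 2 + 2 * (α * m + β * n + γ) + 2 * α * β +
          μ * (α ^ 2 * m + β ^ 2 * n + 2 * γ * (α + β)) := by
  obtain ⟨μ, h1, h2, h3, hA, hB, hAA, hBB⟩ := pure_reduced ψ hψ
  have hρ := isDM_pure hψ
  set ρ := pureDM ψ with hρd
  set A := ptrA ρ with hAd
  set B := ptrB ρ with hBd
  set D : ℝ := (m : ℝ) * n + α * m + β * n + γ with hD
  have hDne : (D : ℂ) ≠ 0 := by exact_mod_cast hdenom.ne'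
  set M : Matrix (Fin m × Fin n) (Fin m × Fin n) ℂ := 1 +
      (α : ℂ) • ((1 : Matrix (Fin m) (Fin m) ℂ) ⊗ₖ A) +
      (β : ℂ) • (B ⊗ₖ (1 : Matrix (Fin n) (Fin n) ℂ)) + (γ : ℂ) • ρ with hM
  have hΦ : bidepol m n α β γ ρ = (D : ℂ)⁻¹ • M := by
    rw [bidepol, hρ.2, one_smul]
  have hMh : Mᴴ = M := by
    rw [hM]
    simp [conjTranspose_add, conjTranspose_smul, conjTranspose_kronecker, hA, hB, hρ.1.1.eq]
  have htA : A.trace = 1 := by rw [hAd, trace_ptrA, hρ.2]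
  have htB : B.trace = 1 := by rw [hBd, trace_ptrB, hρ.2]
  have hMt : M.trace = (D : ℂ) := by
    rw [hM]
    simp [trace_kronecker, htA, htB, hρ.2, hD]
  have hΦh : (bidepol m n α β γ ρ)ᴴ = bidepol m n α β γ ρ := by
    rw [hΦ, conjTranspose_smul, hMh]; simp
  refine ⟨hΦh, ?_, μ, h1, h2, h3, ?_⟩
  · rw [hΦ, trace_smul, hMt, smul_eq_mul, inv_mul_cancel₀ hDne]
  · have hρρ : (ρ * ρ).trace = 1 := by
      have : ρ * ρ = ρ := by
        rw [hρd, pureDM, vecMulVec_mul_vecMulVec]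
        have : star ψ ⬝ᵥ ψ = 1 := by
          have h := hρ.2
          rw [hρd, pureDM, trace_vecMulVec, dotProduct_comm] at h
          exact h
        simp [this]
      rw [this, hρ.2]
    have t1 : (((1 : Matrix (Fin m) (Fin m) ℂ) ⊗ₖ A) * ((1 : Matrix (Fin m) (Fin m) ℂ) ⊗ₖ A)).trace = m * μ := by
      rw [← mul_kronecker_mul, trace_kronecker, hAA]; simp
    have t2 : ((B ⊗ₖ (1 : Matrix (Fin n) (Fin n) ℂ)) * (B ⊗ₖ (1 : Matrix (Fin n) (Fin n) ℂ))).trace = n * μ := by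
      rw [← mul_kronecker_mul, trace_kronecker, hBB]; simp [mul_comm]
    have t3 : (((1 : Matrix (Fin m) (Fin m) ℂ) ⊗ₖ A) * (B ⊗ₖ (1 : Matrix (Fin n) (Fin n) ℂ))).trace = 1 := by
      rw [← mul_kronecker_mul, trace_kronecker]; simp [htA, htB]
    have t3' : ((B ⊗ₖ (1 : Matrix (Fin n) (Fin n) ℂ)) * ((1 : Matrix (Fin m) (Fin m) ℂ) ⊗ₖ A)).trace = 1 := by
      rw [trace_mul_comm, t3]
    have t4 : (((1 : Matrix (Fin m) (Fin m) ℂ) ⊗ₖ A) * ρ).trace = μ := by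
      rw [trace_one_kron, hAA]
    have t4' : (ρ * ((1 : Matrix (Fin m) (Fin m) ℂ) ⊗ₖ A)).trace = μ := by rw [trace_mul_comm, t4]
    have t5 : ((B ⊗ₖ (1 : Matrix (Fin n) (Fin n) ℂ)) * ρ).trace = μ := by
      rw [trace_kron_one, hBB]
    have t5' : (ρ * (B ⊗ₖ (1 : Matrix (Fin n) (Fin n) ℂ))).trace = μ := by rw [trace_mul_comm, t5]
    have t6 : ((1 : Matrix (Fin m) (Fin m) ℂ) ⊗ₖ A).trace = m := by
      rw [trace_kronecker, htA]; simp
    have t7 : (B ⊗ₖ (1 : Matrix (Fin n) (Fin n) ℂ)).trace = n := by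
      rw [trace_kronecker, htB]; simp
    have hMM : (M * M).trace = ((m * n + γ ^ 2 + 2 * (α * m + β * n + γ) + 2 * α * β +
          μ * (α ^ 2 * m + β ^ 2 * n + 2 * γ * (α + β)) : ℝ) : ℂ) := by
      rw [hM]
      simp only [add_mul, mul_add, one_mul, mul_one, smul_mul_assoc, mul_smul_comm, trace_add,
        trace_smul, t1, t2, t3, t3', t4, t4', t5, t5', t6, t7, hρρ, hρ.2, smul_eq_mul, trace_one,
        Fintype.card_prod, Fintype.card_fin]
      push_cast
      ring
    have hfr : frob (bidepol m n α β γ ρ) = (D⁻¹) ^ 2 * (M * M).trace.re := by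
      rw [← frob_eq, hΦh, hΦ, smul_mul_assoc, mul_smul_comm, smul_smul, trace_smul, smul_eq_mul,
        ← Complex.ofReal_inv, ← Complex.ofReal_mul, Complex.re_ofReal_mul]
      ring
    rw [hfr, hMM, Complex.ofReal_re]
    field_simp

def bidepolLin (m n : ℕ) (α β γ : ℝ) :
    Matrix (Fin m × Fin n) (Fin m × Fin n) ℂ →ₗ[ℂ] Matrix (Fin m × Fin n) (Fin m × Fin n) ℂ where
  toFun := bidepol m n α β γ
  map_add' X Y := by
    have hA : ptrA (X + Y) = ptrA X + ptrA Y := by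
      ext; simp [ptrA, Finset.sum_add_distrib]
    have hB : ptrB (X + Y) = ptrB X + ptrB Y := by
      ext; simp [ptrB, Finset.sum_add_distrib]
    simp only [bidepol, hA, hB, trace_add, kronecker_add, add_kronecker, smul_add, add_smul]
    abel
  map_smul' c X := by
    have hA : ptrA (c • X) = c • ptrA X := by
      ext; simp [ptrA, Finset.mul_sum]
    have hB : ptrB (c • X) = c • ptrB X := by
      ext; simp [ptrB, Finset.mul_sum]
    simp only [bidepol, hA, hB, trace_smul, kronecker_smul, smul_kronecker, RingHom.id_apply, smul_eq_mul]
    simp only [smul_add, smul_smul]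
    ring_nf

lemma dm_decomp {τ : Type*} [Fintype τ] [DecidableEq τ] (ρ : Matrix τ τ ℂ) (hρ : IsDM ρ) :
    ∃ (p : τ → ℝ) (v : τ → τ → ℂ), (∀ k, 0 ≤ p k) ∧ ∑ k, p k = 1 ∧ (∀ k, v k ∈ unitVec τ) ∧
      ρ = ∑ k, (p k : ℂ) • pureDM (v k) := by
  have hh := hρ.1.1
  set V := (hh.eigenvectorUnitary : Matrix τ τ ℂ) with hV
  have hV1 : Vᴴ * V = 1 := Unitary.coe_star_mul_self _
  have hs : ρ = V * diagonal (fun i => ((hh.eigenvalues i : ℝ) : ℂ)) * Vᴴ := by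
    have hs := hh.spectral_theorem
    rw [Unitary.conjStarAlgAut_apply] at hs
    exact hs
  refine ⟨hh.eigenvalues, fun k i => V i k, hρ.1.eigenvalues_nonneg, ?_, ?_, ?_⟩
  · have := hh.trace_eq_sum_eigenvalues
    rw [hρ.2] at this
    have h2 : ((∑ k, hh.eigenvalues k : ℝ) : ℂ) = 1 := by rw [this]; simp
    exact_mod_cast h2
  · intro k
    have := congrFun (congrFun hV1 k) k
    rw [Matrix.mul_apply, one_apply_eq] at this
    have h2 : ((∑ i, Complex.normSq (V i k) : ℝ) : ℂ) = 1 := by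
      rw [← this]; simp [Complex.normSq_eq_conj_mul_self]
    change ∑ i, Complex.normSq (V i k) = 1
    exact_mod_cast h2
  · conv_lhs => rw [hs]
    ext i j
    rw [Matrix.mul_apply, Matrix.sum_apply]
    simp only [mul_diagonal, Matrix.smul_apply, pureDM, vecMulVec_apply, Pi.star_apply, conjTranspose_apply, smul_eq_mul]
    refine Finset.sum_congr rfl fun k _ => ?_
    ring

theorem stmt19 (m n : ℕ) (hm : 2 ≤ m) (hn : 2 ≤ n) (α β γ : ℝ)
    (hdenom : 0 < (m : ℝ) * n + α * m + β * n + γ)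
    (hpos : ∀ X : Matrix (Fin m × Fin n) (Fin m × Fin n) ℂ,
      X.PosSemidef → (bidepol m n α β γ X).PosSemidef)
    (hcond :
      (0 ≤ α ^ 2 * m + β ^ 2 * n + 2 * γ * (α + β) ∧
        (α + β + γ) ^ 2 + α ^ 2 * ((m : ℝ) - 1) + β ^ 2 * ((n : ℝ) - 1) - 1 ≤
          (α * m + β * n + γ + 1) ^ 2 / ((m : ℝ) * n - 1)) ∨
      (α ^ 2 * m + β ^ 2 * n + 2 * γ * (α + β) ≤ 0 ∧
        γ ^ 2 + 2 * α * β - 1 +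
            (α ^ 2 * m + β ^ 2 * n + 2 * γ * (α + β)) / min (m : ℝ) (n : ℝ) ≤
          (α * m + β * n + γ + 1) ^ 2 / ((m : ℝ) * n - 1))) :
    ∀ ρ : Matrix (Fin m × Fin n) (Fin m × Fin n) ℂ, IsDM ρ →
      IsAbsSep (bidepol m n α β γ ρ) := by
  intro ρ hρ U hU
  have hU' : Uᴴ * U = 1 := mul_eq_one_comm.1 hU
  have hm' : (2:ℝ) ≤ m := by exact_mod_cast hm
  have hn' : (2:ℝ) ≤ n := by exact_mod_cast hn
  have hmn : (1:ℝ) < (m:ℝ) * n := by nlinarith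
  obtain ⟨p, v, hp0, hp1, hv, hρe⟩ := dm_decomp ρ hρ
  apply hull_isSep
  have hsum : U * bidepol m n α β γ ρ * Uᴴ =
      ∑ k, p k • (U * bidepol m n α β γ (pureDM (v k)) * Uᴴ) := by
    have h1 : bidepol m n α β γ ρ = ∑ k, (p k : ℂ) • bidepol m n α β γ (pureDM (v k)) := by
      have := congrArg (bidepolLin m n α β γ) hρe
      rw [map_sum] at this
      simp only [map_smul] at this
      exact this
    rw [h1, Matrix.mul_sum, Matrix.sum_mul]
    refine Finset.sum_congr rfl fun k _ => ?_
    rw [mul_smul_comm, smul_mul_assoc]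
    ext i j
    simp
  rw [hsum]
  refine (convex_convexHull ℝ _).sum_mem (fun k _ => hp0 k) hp1 fun k _ => ?_
  obtain ⟨hh, ht, μ, hμ1, hμm, hμn, hf⟩ := bidepol_pure α β γ hdenom (v k) (hv k)
  set X := bidepol m n α β γ (pureDM (v k)) with hX
  have hh' : (U * X * Uᴴ)ᴴ = U * X * Uᴴ := by
    simp [conjTranspose_mul, hh, Matrix.mul_assoc]
  have hfU : frob (U * X * Uᴴ) = frob X := by
    rw [← frob_eq, ← frob_eq, hh', hh]
    rw [show U * X * Uᴴ * (U * X * Uᴴ) = U * (X * (Uᴴ * U) * X) * Uᴴ by simp only [Matrix.mul_assoc],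
      hU', mul_one, trace_mul_comm, ← Matrix.mul_assoc, hU', one_mul]
  have hcard : (Fintype.card (Fin m × Fin n) : ℝ) = m * n := by simp
  refine gurvits_barnum _ hh' ?_ ?_ ?_
  · rw [trace_mul_comm, ← Matrix.mul_assoc, hU', one_mul, ht]
  · rw [hcard]; exact hmn
  · rw [hcard, hfU]
    set D := (m : ℝ) * n + α * m + β * n + γ with hD
    set K := α ^ 2 * m + β ^ 2 * n + 2 * γ * (α + β) with hK
    have hmn1 : (0:ℝ) < (m:ℝ) * n - 1 := by linarith
    have key : γ ^ 2 + 2 * α * β - 1 + μ * K ≤ (α * m + β * n + γ + 1) ^ 2 / ((m : ℝ) * n - 1) := by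
      rcases hcond with ⟨hK0, hc⟩ | ⟨hK0, hc⟩
      · refine le_trans ?_ hc
        nlinarith
      · refine le_trans ?_ hc
        have hmin : 0 < min (m:ℝ) n := lt_min (by linarith) (by linarith)
        have hμmin : 1 ≤ min (m:ℝ) n * μ := by
          rcases min_choice (m:ℝ) n with h | h <;> rw [h] <;> assumption
        have : μ * K ≤ K / min (m:ℝ) n := by
          rw [le_div_iff₀ hmin]
          nlinarith
        linarith
    rw [le_div_iff₀ hmn1] at key
    have hD2 : 0 < D ^ 2 := by positivity
    have hfin : frob X * D ^ 2 * (m * n - 1) ≤ D ^ 2 := by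
      rw [hf, hD]
      nlinarith
    have : (frob X * (m * n - 1)) * D ^ 2 ≤ 1 * D ^ 2 := by linarith
    exact le_of_mul_le_mul_right this hD2

end
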